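/- arXiv:1901.08846 — 6 statements merged into one kernel-verified Lean document; each statement's English description precedes it below -/
import Mathlib

section
/- (Theorem 2) Let α > 0. Suppose F is a feasible prediction profile with F^k_j ∈ (0,1) for all k ∈ {1,…,K} and j ∈ {1,…,L}, and F is a local minimizer of the function F ↦ L_ECE(F) − α·H(F_en) on the set of feasible prediction profiles. Then for all k ∈ {1,…,K} and all j ∈ {1,…,L}∖{y}: F^k_y = F_en_y, F_en_j = (1 − F_en_y)/(L − 1), and 1/F_en_y = (α/K)·log( F_en_y·(L−1)/(1 − F_en_y) ). -/
noncomputable section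

/-- A feasible prediction profile: `K` probability vectors over `L` classes. -/
def Feasible (K L : ℕ) (F : Fin K → Fin L → ℝ) : Prop :=
  (∀ k j, 0 ≤ F k j) ∧ ∀ k, ∑ j, F k j = 1

/-- The ensemble cross-entropy loss `L_ECE(F) = −∑_k log F^k_y`. -/
def LECE (K L : ℕ) (y : Fin L) (F : Fin K → Fin L → ℝ) : ℝ :=
  - ∑ k, Real.log (F k y)

/-- The ensemble prediction `F_en = (1/K) ∑_k F^k`. -/
def Fen (K L : ℕ) (F : Fin K → Fin L → ℝ) : Fin L → ℝ :=
  fun j => (∑ k, F k j) / (K : ℝ)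

/-- The Shannon entropy `H(v) = −∑_j v_j log v_j`. -/
def Hen (L : ℕ) (v : Fin L → ℝ) : ℝ :=
  - ∑ j, v j * Real.log (v j)

open Filter Topology

/-- A perturbation direction with zero row sums keeps an interior profile feasible for small `t`. -/
lemma eventually_feasible_add_smul {K L : ℕ} {F D : Fin K → Fin L → ℝ} (hF : Feasible K L F)
    (hpos : ∀ k j, 0 < F k j) (hD : ∀ k, ∑ j, D k j = 0) :
    ∀ᶠ t : ℝ in 𝓝 0, Feasible K L (F + t • D) := by
  have hnonneg : ∀ᶠ t : ℝ in 𝓝 0, ∀ k j, 0 ≤ F k j + t * D k j := by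
    refine eventually_all.2 fun k => eventually_all.2 fun j => ?_
    have hc : ContinuousAt (fun t : ℝ => F k j + t * D k j) 0 := by fun_prop
    exact (hc.eventually_const_lt (by simpa using hpos k j)).mono fun t ht => ht.le
  filter_upwards [hnonneg] with t ht
  refine ⟨fun k j => by simpa using ht k j, fun k => ?_⟩
  simp [Finset.sum_add_distrib, ← Finset.mul_sum, hD k, hF.2 k]

/-- The directional derivative of the regularized ensemble loss at an interior profile. -/
lemma hasDerivAt_regularized_loss {K L : ℕ} (y : Fin L) (α : ℝ) {F : Fin K → Fin L → ℝ}
    (D : Fin K → Fin L → ℝ) (hy : ∀ k, F k y ≠ 0) (hen : ∀ j, Fen K L F j ≠ 0) :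
    HasDerivAt (fun t : ℝ => LECE K L y (F + t • D) - α * Hen L (Fen K L (F + t • D)))
      (-∑ k, D k y / F k y + α * ∑ j, (Real.log (Fen K L F j) + 1) * Fen K L D j) 0 := by
  have hline : ∀ k j, HasDerivAt (fun t : ℝ => (F + t • D) k j) (D k j) 0 := fun k j => by
    simpa using ((hasDerivAt_id (0 : ℝ)).mul_const (D k j)).const_add (F k j)
  have hlog : HasDerivAt (fun t : ℝ => LECE K L y (F + t • D)) (-∑ k, D k y / F k y) 0 := by
    refine (HasDerivAt.fun_sum fun k _ => ?_).fun_neg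
    simpa using (hline k y).log (by simpa using hy k)
  have hmean : ∀ j, HasDerivAt (fun t : ℝ => Fen K L (F + t • D) j) (Fen K L D j) 0 := fun j =>
    (HasDerivAt.fun_sum fun k _ => hline k j).div_const _
  have hent : HasDerivAt (fun t : ℝ => Hen L (Fen K L (F + t • D)))
      (-∑ j, (Real.log (Fen K L F j) + 1) * Fen K L D j) 0 := by
    refine (HasDerivAt.fun_sum fun j _ => ?_).fun_neg
    have h := Real.hasDerivAt_mul_log (hen j)
    exact HasDerivAt.comp_of_eq (0 : ℝ) h (hmean j) (by simp)
  exact (hlog.fun_sub (hent.const_mul α)).congr_deriv (by rw [mul_neg, sub_neg_eq_add])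

/-- Stationarity under moving mass from the label `j` to the label `y` in the member `k`. -/
lemma inv_eq_of_isLocalMinOn {K L : ℕ} {y : Fin L} {α : ℝ} {F : Fin K → Fin L → ℝ}
    (hF : Feasible K L F) (hpos : ∀ k j, 0 < F k j)
    (hmin : IsLocalMinOn (fun G => LECE K L y G - α * Hen L (Fen K L G))
      {G | Feasible K L G} F) (k : Fin K) {j : Fin L} (hj : j ≠ y) :
    1 / F k y = (α / K) * (Real.log (Fen K L F y) - Real.log (Fen K L F j)) := by
  have hK : (0 : ℝ) < K := by exact_mod_cast k.pos
  set v : Fin L → ℝ := Pi.single y 1 - Pi.single j 1 with hv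
  set D : Fin K → Fin L → ℝ := Pi.single k v with hDdef
  have hD : ∀ m, ∑ i, D m i = 0 := fun m => by
    rcases eq_or_ne m k with rfl | hm
    · simp [hDdef, hv]
    · simp [hDdef, hm]
  have hDy : ∑ m, D m y / F m y = 1 / F k y := by
    rw [Finset.sum_eq_single k (fun m _ hm => by simp [hDdef, hm]) (by simp)]
    simp [hDdef, hv, hj.symm]
  have hDen : ∀ i, Fen K L D i = v i / K := fun i => by
    unfold Fen
    rw [Finset.sum_eq_single k (fun m _ hm => by simp [hDdef, hm]) (by simp)]
    simp [hDdef]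
  have hen : ∀ i, Fen K L F i ≠ 0 := fun i =>
    (div_pos (Finset.sum_pos (fun m _ => hpos m i) ⟨k, Finset.mem_univ k⟩) hK).ne'
  have hderiv := hasDerivAt_regularized_loss y α D (fun m => (hpos m y).ne') hen
  have htend : Tendsto (fun t : ℝ => F + t • D) (𝓝 0) (𝓝[{G | Feasible K L G}] F) := by
    refine tendsto_nhdsWithin_iff.2 ⟨?_, eventually_feasible_add_smul hF hpos hD⟩
    have hc : Continuous (fun t : ℝ => F + t • D) := by fun_prop
    simpa using hc.tendsto 0
  have hloc : IsLocalMin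
      (fun t : ℝ => LECE K L y (F + t • D) - α * Hen L (Fen K L (F + t • D))) 0 := by
    filter_upwards [htend.eventually hmin] with t ht
    simpa using ht
  have hzero := hloc.hasDerivAt_eq_zero hderiv
  have hsum : ∑ i, (Real.log (Fen K L F i) + 1) * Fen K L D i
      = (Real.log (Fen K L F y) - Real.log (Fen K L F j)) / K := by
    simp only [hDen, hv, Pi.sub_apply, mul_div_assoc', mul_sub, ← Finset.sum_div,
      Finset.sum_sub_distrib]
    simp [Pi.single_apply]
  rw [hDy, hsum] at hzero
  linear_combination -hzero

/-- **Theorem 2**: for `α > 0`, any interior local minimizer of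
`F ↦ L_ECE(F) − α·H(F_en)` on the feasible set satisfies `F^k_y = F_en_y`,
`F_en_j = (1 − F_en_y)/(L − 1)` for `j ≠ y`, and
`1/F_en_y = (α/K)·log( F_en_y (L−1) / (1 − F_en_y) )`. -/
theorem adp_entropy_only_optima (K L : ℕ) (hK : 1 ≤ K) (hL : 2 ≤ L) (y : Fin L)
    (α : ℝ) (hα : 0 < α)
    (F : Fin K → Fin L → ℝ) (hF : Feasible K L F)
    (hFo : ∀ k j, F k j ∈ Set.Ioo (0 : ℝ) 1)
    (hmin : IsLocalMinOn (fun G => LECE K L y G - α * Hen L (Fen K L G))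
      {G | Feasible K L G} F) :
    (∀ k, F k y = Fen K L F y) ∧
    (∀ j, j ≠ y → Fen K L F j = (1 - Fen K L F y) / ((L : ℝ) - 1)) ∧
    1 / Fen K L F y =
      (α / K) * Real.log (Fen K L F y * ((L : ℝ) - 1) / (1 - Fen K L F y)) := by
  have hK0 : (0 : ℝ) < K := by exact_mod_cast hK
  have hpos : ∀ k j, 0 < F k j := fun k j => (hFo k j).1
  let k₀ : Fin K := ⟨0, hK⟩
  have hen : ∀ j, 0 < Fen K L F j := fun j =>
    div_pos (Finset.sum_pos (fun m _ => hpos m j) ⟨k₀, Finset.mem_univ k₀⟩) hK0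
  have hsum : ∑ j, Fen K L F j = 1 := by
    simp only [Fen]
    rw [← Finset.sum_div, Finset.sum_comm]
    simp [hF.2, hK0.ne']
  have hstat := fun k j (hj : j ≠ y) => inv_eq_of_isLocalMinOn hF hpos hmin k hj
  have : Nontrivial (Fin L) := Fin.nontrivial_iff_two_le.2 hL
  obtain ⟨j₀, hj₀⟩ := exists_ne y
  have hmember : ∀ k, F k y = Fen K L F y := fun k => by
    have hconst : ∀ m, F m y = F k y := fun m => by
      have h := (hstat m j₀ hj₀).trans (hstat k j₀ hj₀).symm
      simpa using h
    simp [Fen, hconst, hK0.ne']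
  have hother : ∀ j, j ≠ y → Fen K L F j = Fen K L F j₀ := fun j hj => by
    have h := (hstat k₀ j hj).symm.trans (hstat k₀ j₀ hj₀)
    have h' := mul_left_cancel₀ (div_pos hα hK0).ne' h
    exact Real.log_injOn_pos (hen j) (hen j₀) (sub_right_injective h')
  have hL1 : (0 : ℝ) < (L : ℝ) - 1 := by
    have : (2 : ℝ) ≤ L := by exact_mod_cast hL
    linarith
  have huniform : ∀ j, j ≠ y → Fen K L F j = (1 - Fen K L F y) / ((L : ℝ) - 1) := fun j hj => by
    rw [hother j hj, eq_div_iff hL1.ne']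
    rw [← Finset.add_sum_erase _ _ (Finset.mem_univ y), Finset.sum_congr rfl
      fun i hi => hother i (Finset.ne_of_mem_erase hi)] at hsum
    rw [Finset.sum_const, Finset.card_erase_of_mem (Finset.mem_univ y), Finset.card_univ,
      Fintype.card_fin, nsmul_eq_mul, Nat.cast_sub (by omega), Nat.cast_one] at hsum
    linarith
  refine ⟨hmember, huniform, ?_⟩
  have h := hstat k₀ j₀ hj₀
  rwa [hmember, ← Real.log_div (hen y).ne' (hen j₀).ne', huniform j₀ hj₀, div_div_eq_mul_div] at h
end
end

section
/- (KKT algebra underlying Theorem 2) Let α > 0 and let F be a feasible prediction profile with F^k_j ∈ (0,1) for all k, j. Suppose there exist real numbers ω_1,…,ω_K such that for every k ∈ {1,…,K}: −1/F^k_y + (α/K)·(1 + log F_en_y) = ω_k, and for every j ∈ {1,…,L}∖{y}: (α/K)·(1 + log F_en_j) = ω_k. Then for all k and all j ≠ y: F^k_y = F_en_y, F_en_j = (1 − F_en_y)/(L − 1), and 1/F_en_y = (α/K)·log( F_en_y·(L−1)/(1 − F_en_y) ). -/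
noncomputable section

theorem Fen_pos {K L : ℕ} (hK : 1 ≤ K) {F : Fin K → Fin L → ℝ} {j : Fin L}
    (hF : ∀ k, 0 < F k j) : 0 < Fen K L F j := by
  have : Nonempty (Fin K) := ⟨⟨0, hK⟩⟩
  exact div_pos (Finset.sum_pos (fun k _ => hF k) Finset.univ_nonempty) (by exact_mod_cast hK)

theorem Feasible.sum_Fen {K L : ℕ} (hK : 1 ≤ K) {F : Fin K → Fin L → ℝ}
    (hF : Feasible K L F) : ∑ j, Fen K L F j = 1 := by
  have hK0 : (K : ℝ) ≠ 0 := by exact_mod_cast (by lia : K ≠ 0)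
  simp only [Fen]
  rw [← Finset.sum_div, Finset.sum_comm]
  simp [hF.2, hK0]

theorem Fen_eq_of_forall_eq {K L : ℕ} (hK : 1 ≤ K) {F : Fin K → Fin L → ℝ} {j : Fin L} {c : ℝ}
    (hF : ∀ k, F k j = c) : Fen K L F j = c := by
  have hK0 : (K : ℝ) ≠ 0 := by exact_mod_cast (by lia : K ≠ 0)
  simp [Fen, hF, hK0]

/-- A vector of total mass one that is constant off `y` spreads the remaining mass evenly. -/
theorem eq_div_of_sum_eq_one_of_const_off {L : ℕ} (hL : 2 ≤ L) {p : Fin L → ℝ} {y : Fin L} {c : ℝ}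
    (hsum : ∑ j, p j = 1) (hc : ∀ j, j ≠ y → p j = c) : c = (1 - p y) / ((L : ℝ) - 1) := by
  have hL1 : (0 : ℝ) < (L : ℝ) - 1 := by
    have : (2 : ℝ) ≤ L := by exact_mod_cast hL
    linarith
  rw [← Finset.add_sum_erase _ _ (Finset.mem_univ y),
    Finset.sum_congr rfl (fun j hj => hc j (Finset.ne_of_mem_erase hj)), Finset.sum_const,
    Finset.card_erase_of_mem (Finset.mem_univ y), Finset.card_univ, Fintype.card_fin,
    nsmul_eq_mul, Nat.cast_sub (by lia), Nat.cast_one] at hsum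
  rw [eq_div_iff hL1.ne']
  linarith

/-- **KKT algebra underlying Theorem 2**: if an interior feasible profile satisfies the
stationarity conditions of the Lagrangian of `min L_ECE − α·H(F_en)` with multipliers
`ω_k`, then `F^k_y = F_en_y`, `F_en_j = (1 − F_en_y)/(L − 1)` for `j ≠ y`, and
`1/F_en_y = (α/K)·log( F_en_y (L−1) / (1 − F_en_y) )`. -/
theorem adp_entropy_kkt_algebra (K L : ℕ) (hK : 1 ≤ K) (hL : 2 ≤ L) (y : Fin L)
    (α : ℝ) (hα : 0 < α)
    (F : Fin K → Fin L → ℝ) (hF : Feasible K L F)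
    (hFo : ∀ k j, F k j ∈ Set.Ioo (0 : ℝ) 1)
    (ω : Fin K → ℝ)
    (hky : ∀ k, -(1 / F k y) + (α / K) * (1 + Real.log (Fen K L F y)) = ω k)
    (hkj : ∀ k, ∀ j, j ≠ y → (α / K) * (1 + Real.log (Fen K L F j)) = ω k) :
    (∀ k, F k y = Fen K L F y) ∧
    (∀ j, j ≠ y → Fen K L F j = (1 - Fen K L F y) / ((L : ℝ) - 1)) ∧
    1 / Fen K L F y =
      (α / K) * Real.log (Fen K L F y * ((L : ℝ) - 1) / (1 - Fen K L F y)) := by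
  have hαK : 0 < α / K := div_pos hα (by exact_mod_cast hK)
  have hpos : ∀ j, 0 < Fen K L F j := fun j => Fen_pos hK fun k => (hFo k j).1
  have : Nontrivial (Fin L) := Fin.nontrivial_iff_two_le.mpr hL
  obtain ⟨i, hi⟩ := exists_ne y
  let k₀ : Fin K := ⟨0, hK⟩
  have hconst : ∀ j, j ≠ y → Fen K L F j = Fen K L F i := fun j hj => by
    have h := mul_left_cancel₀ hαK.ne' ((hkj k₀ j hj).trans (hkj k₀ i hi).symm)
    exact Real.log_injOn_pos (hpos j) (hpos i) (add_left_cancel h)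
  have hinv : ∀ k, 1 / F k y =
      (α / K) * (Real.log (Fen K L F y) - Real.log (Fen K L F i)) := fun k => by
    linarith [hky k, hkj k i hi]
  have heq : ∀ k, F k y = Fen K L F y := fun k => by
    refine (Fen_eq_of_forall_eq hK fun k' => ?_).symm
    have h := (hinv k').trans (hinv k).symm
    rwa [one_div, one_div, inv_inj] at h
  have hval := eq_div_of_sum_eq_one_of_const_off hL (hF.sum_Fen hK) hconst
  refine ⟨heq, fun j hj => (hconst j hj).trans hval, ?_⟩
  rw [← heq k₀, hinv k₀, ← Real.log_div (hpos y).ne' (hpos i).ne', heq k₀, hval, div_div_eq_mul_div]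
end
end

section
/- Let α > 0, K ≥ 1 and L ≥ 2. The function g(p) = (α/K)·log( p(L−1)/(1−p) ) − 1/p is strictly increasing on (0,1), satisfies g(p) < 0 for all p ∈ (0, 1/L], and tends to +∞ as p → 1⁻. Consequently the equation 1/p = (α/K)·log( p(L−1)/(1−p) ) (Eq. (2) of the paper) has a unique solution p* in (0,1), and this solution lies in (1/L, 1). -/
theorem strictMonoOn_mul_log_odds_sub_inv {c m : ℝ} (hc : 0 < c) (hm : 0 < m) :
    StrictMonoOn (fun p : ℝ => c * Real.log (p * m / (1 - p)) - 1 / p) (Set.Ioo 0 1) := by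
  rintro x ⟨hx0, hx1⟩ y ⟨hy0, hy1⟩ hxy
  have hx : 0 < 1 - x := by linarith
  have hy : 0 < 1 - y := by linarith
  have hodds : x * m / (1 - x) < y * m / (1 - y) := by gcongr
  have hlog := mul_lt_mul_of_pos_left (Real.log_lt_log (by positivity) hodds) hc
  have hinv := one_div_lt_one_div_of_lt hx0 hxy
  simp only
  linarith

theorem continuousOn_mul_log_odds_sub_inv {c m : ℝ} (hm : m ≠ 0) :
    ContinuousOn (fun p : ℝ => c * Real.log (p * m / (1 - p)) - 1 / p) (Set.Ioo 0 1) := by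
  have hne : ∀ p ∈ Set.Ioo (0 : ℝ) 1, 1 - p ≠ 0 := fun p hp => (sub_pos.mpr hp.2).ne'
  refine ContinuousOn.sub (continuousOn_const.mul (ContinuousOn.log ?_ ?_)) ?_
  · exact ContinuousOn.div (by fun_prop) (by fun_prop) hne
  · exact fun p hp => div_ne_zero (mul_ne_zero hp.1.ne' hm) (hne p hp)
  · exact ContinuousOn.div (by fun_prop) (by fun_prop) fun p hp => hp.1.ne'

theorem tendsto_mul_log_odds_sub_inv_atTop {c m : ℝ} (hc : 0 < c) (hm : 0 < m) :
    Filter.Tendsto (fun p : ℝ => c * Real.log (p * m / (1 - p)) - 1 / p)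
      (nhdsWithin 1 (Set.Iio 1)) Filter.atTop := by
  have hid : Filter.Tendsto (fun p : ℝ => p) (nhdsWithin 1 (Set.Iio 1)) (nhds 1) :=
    Filter.tendsto_id.mono_left nhdsWithin_le_nhds
  have hsub : Filter.Tendsto (fun p : ℝ => 1 - p) (nhdsWithin 1 (Set.Iio 1))
      (nhdsWithin 0 (Set.Ioi 0)) := by
    refine tendsto_nhdsWithin_iff.mpr ⟨by simpa using hid.const_sub 1, ?_⟩
    filter_upwards [self_mem_nhdsWithin] with p hp
    exact sub_pos.mpr (Set.mem_Iio.mp hp)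
  have hodds : Filter.Tendsto (fun p : ℝ => p * m / (1 - p)) (nhdsWithin 1 (Set.Iio 1))
      Filter.atTop := by
    simp only [div_eq_mul_inv]
    exact (hid.mul_const m).pos_mul_atTop (by simpa using hm) hsub.inv_tendsto_nhdsGT_zero
  have hinv : Filter.Tendsto (fun p : ℝ => -(1 / p)) (nhdsWithin 1 (Set.Iio 1))
      (nhds (-(1 / 1))) := (tendsto_const_nhds.div hid one_ne_zero).neg
  simpa only [sub_eq_add_neg, Function.comp_apply] using
    ((Real.tendsto_log_atTop.comp hodds).const_mul_atTop hc).atTop_add hinv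

/-- The function `g(p) = (α/K)·log( p(L−1)/(1−p) ) − 1/p` is strictly increasing on
`(0,1)`, negative on `(0, 1/L]`, and tends to `+∞` as `p → 1⁻`. Consequently Eq. (2) of
the paper, `1/p = (α/K)·log( p(L−1)/(1−p) )`, has a unique solution in `(0,1)`, and this
solution lies in `(1/L, 1)`. -/
theorem eq2_unique_root (α : ℝ) (hα : 0 < α) (K L : ℕ) (hK : 1 ≤ K) (hL : 2 ≤ L)
    (g : ℝ → ℝ)
    (hg : g = fun p => (α / K) * Real.log (p * ((L : ℝ) - 1) / (1 - p)) - 1 / p) :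
    StrictMonoOn g (Set.Ioo 0 1) ∧
    (∀ p ∈ Set.Ioc (0 : ℝ) (1 / (L : ℝ)), g p < 0) ∧
    Filter.Tendsto g (nhdsWithin 1 (Set.Iio 1)) Filter.atTop ∧
    (∃! p, p ∈ Set.Ioo (0 : ℝ) 1 ∧
      1 / p = (α / K) * Real.log (p * ((L : ℝ) - 1) / (1 - p))) ∧
    (∀ p ∈ Set.Ioo (0 : ℝ) 1,
      1 / p = (α / K) * Real.log (p * ((L : ℝ) - 1) / (1 - p)) →
      p ∈ Set.Ioo (1 / (L : ℝ)) 1) := by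
  have hc : 0 < α / K := div_pos hα (by exact_mod_cast hK)
  have hL2 : (2 : ℝ) ≤ L := by exact_mod_cast hL
  have hL1 : (0 : ℝ) < (L : ℝ) - 1 := by linarith
  have hL0 : (0 : ℝ) < L := by linarith
  have hinv0 : 0 < 1 / (L : ℝ) := by positivity
  have hinv1 : 1 / (L : ℝ) < 1 := by rw [div_lt_one hL0]; linarith
  have hmono : StrictMonoOn g (Set.Ioo 0 1) := by
    subst hg
    exact strictMonoOn_mul_log_odds_sub_inv hc hL1
  have hneg : ∀ p ∈ Set.Ioc (0 : ℝ) (1 / (L : ℝ)), g p < 0 := by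
    rintro p ⟨hp0, hp1⟩
    have h1p : 0 < 1 - p := by linarith
    have hpL : p * L ≤ 1 := (le_div_iff₀ hL0).mp hp1
    have hlog : Real.log (p * ((L : ℝ) - 1) / (1 - p)) ≤ 0 := by
      apply Real.log_nonpos
      · positivity
      · rw [div_le_one h1p]
        linarith
    have hip : 0 < 1 / p := by positivity
    have hmul := mul_nonpos_of_nonneg_of_nonpos hc.le hlog
    simp only [hg]
    linarith
  have htend : Filter.Tendsto g (nhdsWithin 1 (Set.Iio 1)) Filter.atTop := by
    subst hg
    exact tendsto_mul_log_odds_sub_inv_atTop hc hL1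
  have hroot : ∀ p, 1 / p = (α / K) * Real.log (p * ((L : ℝ) - 1) / (1 - p)) ↔ g p = 0 := by
    intro p
    simp only [hg]
    rw [sub_eq_zero, eq_comm]
  have hcont : ContinuousOn g (Set.Ioo 0 1) := by
    subst hg
    exact continuousOn_mul_log_odds_sub_inv hL1.ne'
  refine ⟨hmono, hneg, htend, ?_, ?_⟩
  · obtain ⟨q, hq, hq0, hq1⟩ := ((htend.eventually_gt_atTop 0).and
      (Ioo_mem_nhdsLT hinv1)).exists
    have hsub : Set.Icc (1 / (L : ℝ)) q ⊆ Set.Ioo 0 1 := fun x hx =>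
      ⟨hinv0.trans_le hx.1, hx.2.trans_lt hq1⟩
    obtain ⟨p, hp, hgp⟩ := intermediate_value_Icc hq0.le (hcont.mono hsub)
      ⟨(hneg _ ⟨hinv0, le_rfl⟩).le, hq.le⟩
    refine ⟨p, ⟨hsub hp, (hroot p).mpr hgp⟩, ?_⟩
    rintro r ⟨hr, hgr⟩
    exact hmono.injOn hr (hsub hp) (((hroot r).mp hgr).trans hgp.symm)
  · rintro p hp hgp
    refine ⟨?_, hp.2⟩
    by_contra! hle
    exact (hneg p ⟨hp.1, hle⟩).ne ((hroot p).mp hgp)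
end

section
/- Assume K divides L−1, let p ∈ (0,1), and let {s_1,…,s_K} be a partition of the index set {1,…,L}∖{y} with |s_k| = (L−1)/K for each k. Define F^k ∈ ℝ^L by F^k_y = p, F^k_j = K(1−p)/(L−1) for j ∈ s_k, and F^k_j = 0 for j ∉ s_k ∪ {y} (this is the configuration of Eq. (8) of the paper). Then F = (F^1,…,F^K) is a feasible prediction profile, its ensemble prediction satisfies F_en_y = p and F_en_j = (1−p)/(L−1) for all j ≠ y, the normalized non-maximal prediction vectors F̃^1_{∖y},…,F̃^K_{∖y} are pairwise orthogonal unit vectors, and ED(F) = 1 (so the LED term log ED attains its maximal value 0 at F). -/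
noncomputable section

/-- The non-maximal part `F^k_{∖y}`: the vector with the `y`-th coordinate deleted,
represented here as the vector in `ℝ^L` whose `y`-th coordinate is set to `0`
(deleting the `y`-th coordinate is a linear isometry on this subspace, so norms,
inner products and the Gram determinant below coincide with the `(L−1)`-dimensional
formulation of the paper). -/
def delVec (L : ℕ) (y : Fin L) (v : Fin L → ℝ) : Fin L → ℝ :=
  fun j => if j = y then 0 else v j

/-- `F̃^k_{∖y}`: the `L₂`-normalization of the non-maximal part. -/
def tilde (L : ℕ) (y : Fin L) (v : Fin L → ℝ) : Fin L → ℝ :=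
  fun j => delVec L y v j / Real.sqrt (∑ i, (delVec L y v i) ^ 2)

/-- Ensemble diversity `ED(F) = det(M̃ᵀ M̃)`: the determinant of the Gram matrix of the
normalized non-maximal predictions `F̃^1_{∖y}, …, F̃^K_{∖y}`. -/
def ED (K L : ℕ) (y : Fin L) (F : Fin K → Fin L → ℝ) : ℝ :=
  Matrix.det (Matrix.of fun k l : Fin K => ∑ j, tilde L y (F k) j * tilde L y (F l) j)

/-- The configuration of Eq. (8) of the paper: if `K ∣ (L−1)`, `p ∈ (0,1)`, and
`{s_1,…,s_K}` is a partition of `{1,…,L}∖{y}` into sets of size `(L−1)/K`, then the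
profile with `F^k_y = p`, `F^k_j = K(1−p)/(L−1)` on `s_k` and `0` elsewhere is feasible,
has ensemble prediction `F_en_y = p` and `F_en_j = (1−p)/(L−1)` for `j ≠ y`, its
normalized non-maximal predictions are pairwise orthogonal unit vectors, and
`ED(F) = 1` (so the LED term `log ED` attains its maximal value `0`). -/
theorem eq8_configuration (K L : ℕ) (hK : 1 ≤ K) (hL : 2 ≤ L) (hdvd : K ∣ (L - 1))
    (y : Fin L) (p : ℝ) (hp : p ∈ Set.Ioo (0 : ℝ) 1)
    (s : Fin K → Finset (Fin L))
    (hcard : ∀ k, (s k).card = (L - 1) / K)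
    (hdisj : ∀ k l, k ≠ l → Disjoint (s k) (s l))
    (hcover : Finset.univ.biUnion s = Finset.univ.erase y)
    (F : Fin K → Fin L → ℝ)
    (hF : ∀ k, F k y = p ∧
      (∀ j ∈ s k, F k j = (K : ℝ) * (1 - p) / ((L : ℝ) - 1)) ∧
      (∀ j, j ≠ y → j ∉ s k → F k j = 0)) :
    Feasible K L F ∧
    Fen K L F y = p ∧
    (∀ j, j ≠ y → Fen K L F j = (1 - p) / ((L : ℝ) - 1)) ∧
    (∀ k, ∑ j, (tilde L y (F k) j) ^ 2 = 1) ∧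
    (∀ k l, k ≠ l → ∑ j, tilde L y (F k) j * tilde L y (F l) j = 0) ∧
    ED K L y F = 1 := by
  obtain ⟨hp0, hp1⟩ := hp
  have hKpos : (0 : ℝ) < K := by exact_mod_cast hK
  obtain ⟨n, hn⟩ := hdvd
  have hcard' : ∀ k, (s k).card = n := fun k => by
    rw [hcard k, hn, Nat.mul_div_cancel_left n hK]
  have hLn : (L : ℝ) - 1 = K * n := by
    rw [← Nat.cast_mul, ← hn, Nat.cast_sub (by omega), Nat.cast_one]
  have hnpos : (0 : ℝ) < n := by
    have : n ≠ 0 := by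
      rintro rfl
      omega
    exact_mod_cast Nat.pos_of_ne_zero this
  rw [hLn] at hF ⊢
  have hc : (K : ℝ) * (1 - p) / (K * n) = (1 - p) / n := mul_div_mul_left _ _ hKpos.ne'
  have hcpos : 0 < (1 - p) / n := div_pos (sub_pos.2 hp1) hnpos
  have hys : ∀ k, y ∉ s k := fun k hk => by
    have : y ∈ Finset.univ.biUnion s := Finset.mem_biUnion.2 ⟨k, Finset.mem_univ k, hk⟩
    simp [hcover] at this
  have hdel : ∀ k j, delVec L y (F k) j = if j ∈ s k then (1 - p) / n else 0 := by
    intro k j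
    by_cases hj : j = y
    · simp [delVec, hj, hys k]
    · by_cases hjs : j ∈ s k
      · simp only [delVec, hj, hjs, if_true, if_false]
        rw [(hF k).2.1 j hjs, hc]
      · simp only [delVec, hj, hjs, if_false]
        exact (hF k).2.2 j hj hjs
  have hFdel : ∀ k j, F k j = delVec L y (F k) j + if j = y then p else 0 := by
    intro k j
    by_cases hj : j = y
    · simp [delVec, hj, (hF k).1]
    · simp [delVec, hj]
  have hsq : ∀ k, ∑ j, delVec L y (F k) j ^ 2 = n * ((1 - p) / n) ^ 2 := by
    intro k
    simp [hdel, ite_pow, Finset.sum_ite_mem, hcard']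
  have hsqpos : 0 < (n : ℝ) * ((1 - p) / n) ^ 2 := by positivity
  have hunit : ∀ k, ∑ j, tilde L y (F k) j ^ 2 = 1 := by
    intro k
    simp only [tilde, div_pow, ← Finset.sum_div]
    rw [hsq, Real.sq_sqrt hsqpos.le, div_self hsqpos.ne']
  have horth : ∀ k l, k ≠ l → ∑ j, tilde L y (F k) j * tilde L y (F l) j = 0 := by
    intro k l hkl
    refine Finset.sum_eq_zero fun j _ => ?_
    by_cases hjk : j ∈ s k
    · have hjl : j ∉ s l := Finset.disjoint_left.1 (hdisj k l hkl) hjk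
      simp [tilde, hdel l j, hjl]
    · simp [tilde, hdel k j, hjk]
  refine ⟨⟨fun k j => ?_, fun k => ?_⟩, ?_, fun j hj => ?_, hunit, horth, ?_⟩
  · rw [hFdel, hdel]
    split_ifs <;> positivity
  · simp_rw [hFdel k, hdel]
    simp only [Finset.sum_add_distrib, Finset.sum_ite_mem, Finset.univ_inter, Finset.sum_const,
      hcard', nsmul_eq_mul, Finset.sum_ite_eq', Finset.mem_univ, if_true]
    field_simp
    ring
  · simp only [Fen, (hF _).1, Finset.sum_const, Finset.card_univ, Fintype.card_fin, nsmul_eq_mul]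
    field_simp
  · have hjmem : j ∈ Finset.univ.biUnion s := by simp [hcover, hj]
    obtain ⟨k, -, hk⟩ := Finset.mem_biUnion.1 hjmem
    have hsum : ∑ l, F l j = F k j :=
      Finset.sum_eq_single_of_mem k (Finset.mem_univ k) fun l _ hlk =>
        (hF l).2.2 j hj (Finset.disjoint_left.1 (hdisj k l hlk.symm) hk)
    rw [Fen, hsum, (hF k).2.1 j hk]
    field_simp
  · have hgram : (Matrix.of fun k l : Fin K =>
        ∑ j, tilde L y (F k) j * tilde L y (F l) j) = 1 := by
      ext k l
      rw [Matrix.of_apply, Matrix.one_apply]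
      split_ifs with hkl
      · subst hkl
        simpa only [sq] using hunit k
      · exact horth k l hkl
    rw [ED, hgram, Matrix.det_one]
end
end

section
/- (Appendix Theorem B.1) Let λ > 0 and define the JS-divergence regularizer JSD(F) = H(F_en) − (1/K)∑_{k=1}^K H(F^k). Then there is no feasible prediction profile F with all entries F^k_j ∈ (0,1) that is a local minimizer of the function F ↦ L_ECE(F) − λ·JSD(F) on the set of feasible prediction profiles; i.e., the minimization problem min_F L_ECE − λ·JSD has no solution in (0,1)^{L×K}. -/
noncomputable section

/-- The JS-divergence regularizer `JSD(F) = H(F_en) − (1/K) ∑_k H(F^k)`. -/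
def JSD (K L : ℕ) (F : Fin K → Fin L → ℝ) : ℝ :=
  Hen L (Fen K L F) - (1 / (K : ℝ)) * ∑ k, Hen L (F k)

/-- The segment direction moving mass from class `j` to class `y` in member `k`. -/
def transferDir {K L : ℕ} (k : Fin K) (y j : Fin L) : Fin K → Fin L → ℝ :=
  fun m => if m = k then Pi.single y 1 - Pi.single j 1 else 0

lemma sum_transferDir {K L : ℕ} (k m : Fin K) (y j : Fin L) :
    ∑ i, transferDir k y j m i = 0 := by
  unfold transferDir
  split_ifs <;> simp

lemma sum_sum_transferDir_mul {K L : ℕ} (k : Fin K) (y j : Fin L) (c : Fin K → Fin L → ℝ) :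
    ∑ m, ∑ i, transferDir k y j m i * c m i = c k y - c k j := by
  rw [Finset.sum_eq_single k]
  · simp [transferDir, sub_mul, Finset.sum_sub_distrib, Pi.single_apply]
  · intro m _ hm
    simp [transferDir, hm]
  · simp

lemma hasDerivAt_Hen_line {L : ℕ} {v w : Fin L → ℝ} (hv : ∀ i, v i ≠ 0) (hw : ∑ i, w i = 0) :
    HasDerivAt (fun t : ℝ => Hen L (v + t • w)) (-∑ i, w i * Real.log (v i)) 0 := by
  have h : ∀ i, HasDerivAt (fun t : ℝ => (v i + t * w i) * Real.log (v i + t * w i))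
      ((Real.log (v i) + 1) * w i) 0 := by
    intro i
    have hl : HasDerivAt (fun t : ℝ => v i + t * w i) (w i) 0 := by
      simpa using ((hasDerivAt_id (0 : ℝ)).mul_const (w i)).const_add (v i)
    exact HasDerivAt.comp_of_eq (0 : ℝ) (Real.hasDerivAt_mul_log (hv i)) hl (by simp)
  have hs := (HasDerivAt.fun_sum (u := Finset.univ) fun i _ => h i).fun_neg
  refine hs.congr_deriv (congrArg Neg.neg ?_)
  simp only [add_mul, Finset.sum_add_distrib, one_mul, hw, add_zero]
  exact Finset.sum_congr rfl fun i _ => mul_comm _ _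

lemma hasDerivAt_LECE_line {K L : ℕ} (y : Fin L) {F D : Fin K → Fin L → ℝ}
    (hF : ∀ k, F k y ≠ 0) :
    HasDerivAt (fun t : ℝ => LECE K L y (F + t • D)) (-∑ k, D k y / F k y) 0 := by
  refine (HasDerivAt.fun_sum (u := Finset.univ) fun k _ => ?_).fun_neg
  have hl : HasDerivAt (fun t : ℝ => F k y + t * D k y) (D k y) 0 := by
    simpa using ((hasDerivAt_id (0 : ℝ)).mul_const (D k y)).const_add (F k y)
  simpa using hl.log (by simpa using hF k)

lemma Fen_add_smul {K L : ℕ} (F D : Fin K → Fin L → ℝ) (t : ℝ) :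
    Fen K L (F + t • D) = Fen K L F + t • Fen K L D := by
  ext i
  simp [Fen, Finset.sum_add_distrib, ← Finset.mul_sum, add_div, mul_div_assoc]

lemma hasDerivAt_JSD_line {K L : ℕ} {F D : Fin K → Fin L → ℝ} (hF : ∀ k i, F k i ≠ 0)
    (hen : ∀ i, Fen K L F i ≠ 0) (hD : ∀ k, ∑ i, D k i = 0) :
    HasDerivAt (fun t : ℝ => JSD K L (F + t • D))
      (1 / (K : ℝ) * ∑ k, ∑ i, D k i * (Real.log (F k i) - Real.log (Fen K L F i))) 0 := by
  have hsum : ∑ i, Fen K L D i = 0 := by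
    simp only [Fen, ← Finset.sum_div]
    rw [Finset.sum_comm]
    simp [hD]
  have h1 := hasDerivAt_Hen_line hen hsum
  have h2 := (HasDerivAt.fun_sum (u := Finset.univ) fun k _ =>
    hasDerivAt_Hen_line (hF k) (hD k)).const_mul (1 / (K : ℝ))
  have h3 := h1.fun_sub h2
  simp only [← Fen_add_smul] at h3
  refine h3.congr_deriv ?_
  have : ∑ i, Fen K L D i * Real.log (Fen K L F i) =
      1 / (K : ℝ) * ∑ k, ∑ i, D k i * Real.log (Fen K L F i) := by
    rw [Finset.sum_comm, Finset.mul_sum]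
    refine Finset.sum_congr rfl fun i _ => ?_
    rw [← Finset.sum_mul]
    simp only [Fen]
    ring
  rw [this]
  simp only [mul_sub, Finset.sum_sub_distrib, Finset.sum_neg_distrib]
  ring

lemma eventually_feasible_line {K L : ℕ} {F D : Fin K → Fin L → ℝ} (hF : Feasible K L F)
    (hpos : ∀ k i, 0 < F k i) (hD : ∀ k, ∑ i, D k i = 0) :
    ∀ᶠ t : ℝ in nhds 0, Feasible K L (F + t • D) := by
  have h : ∀ᶠ t : ℝ in nhds 0, ∀ k i, 0 < F k i + t * D k i := by
    refine Filter.eventually_all.2 fun k => Filter.eventually_all.2 fun i => ?_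
    have hc : Continuous fun t : ℝ => F k i + t * D k i := by fun_prop
    exact hc.continuousAt.eventually_const_lt (by simpa using hpos k i)
  filter_upwards [h] with t ht
  refine ⟨fun k i => (ht k i).le, fun k => ?_⟩
  simp [Finset.sum_add_distrib, ← Finset.mul_sum, hF.2 k, hD k]

/-- Some ensemble member favours `y` over `j` at least as much as the ensemble does. -/
lemma exists_mul_Fen_le {K L : ℕ} (hK : 1 ≤ K) (F : Fin K → Fin L → ℝ) (y j : Fin L) :
    ∃ k, F k j * Fen K L F y ≤ F k y * Fen K L F j := by
  have : Nonempty (Fin K) := ⟨⟨0, hK⟩⟩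
  obtain ⟨k, -, hk⟩ := Finset.exists_le_of_sum_le (s := (Finset.univ : Finset (Fin K)))
    (f := fun k => F k j * Fen K L F y) (g := fun k => F k y * Fen K L F j)
    Finset.univ_nonempty (by
      rw [← Finset.sum_mul, ← Finset.sum_mul]
      simp only [Fen]
      exact le_of_eq (by ring))
  exact ⟨k, hk⟩

/-- **Appendix Theorem B.1**: for `λ > 0`, the problem `min_F L_ECE − λ·JSD` has no
solution in `(0,1)^{L×K}`, i.e. no feasible profile with all entries in `(0,1)` is a
local minimizer of `F ↦ L_ECE(F) − λ·JSD(F)` on the set of feasible profiles. -/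
theorem jsd_no_interior_minimizer (K L : ℕ) (hK : 1 ≤ K) (hL : 2 ≤ L) (y : Fin L)
    (lam : ℝ) (hlam : 0 < lam) :
    ¬ ∃ F : Fin K → Fin L → ℝ, Feasible K L F ∧
      (∀ k j, F k j ∈ Set.Ioo (0 : ℝ) 1) ∧
      IsLocalMinOn (fun G => LECE K L y G - lam * JSD K L G)
        {G | Feasible K L G} F := by
  rintro ⟨F, hF, hI, hmin⟩
  have hpos : ∀ k i, 0 < F k i := fun k i => (hI k i).1
  have : Nonempty (Fin K) := ⟨⟨0, hK⟩⟩
  have hen : ∀ i, 0 < Fen K L F i := fun i =>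
    div_pos (Finset.sum_pos (fun k _ => hpos k i) Finset.univ_nonempty) (by exact_mod_cast hK)
  have : Nontrivial (Fin L) := Fin.nontrivial_iff_two_le.2 hL
  obtain ⟨j, hj⟩ := exists_ne y
  obtain ⟨k, hk⟩ := exists_mul_Fen_le hK F y j
  have hD := fun m => sum_transferDir k m y j
  have hderiv := (hasDerivAt_LECE_line y (F := F) (D := transferDir k y j)
    fun m => (hpos m y).ne').sub ((hasDerivAt_JSD_line (fun m i => (hpos m i).ne')
      (fun i => (hen i).ne') hD).const_mul lam)
  have htend : Filter.Tendsto (fun t : ℝ => F + t • transferDir k y j) (nhds 0)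
      (nhdsWithin F {G | Feasible K L G}) := by
    refine tendsto_nhdsWithin_iff.2 ⟨?_, eventually_feasible_line hF hpos hD⟩
    have hc : Continuous fun t : ℝ => F + t • transferDir k y j := by fun_prop
    simpa using hc.tendsto 0
  have hloc : IsLocalMin (fun t : ℝ => LECE K L y (F + t • transferDir k y j) -
      lam * JSD K L (F + t • transferDir k y j)) 0 := by
    have := htend.eventually hmin
    simpa [IsLocalMin, IsMinFilter] using this
  have hzero := hloc.hasDerivAt_eq_zero hderiv
  rw [sum_sum_transferDir_mul k y j
    (fun m i => Real.log (F m i) - Real.log (Fen K L F i))] at hzero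
  have hfirst : ∑ m, transferDir k y j m y / F m y = 1 / F k y := by
    rw [Finset.sum_eq_single k]
    · simp [transferDir, hj.symm]
    · intro m _ hm
      simp [transferDir, hm]
    · simp
  have hlog := Real.log_le_log (mul_pos (hpos k j) (hen y)) hk
  rw [Real.log_mul (hpos k j).ne' (hen y).ne', Real.log_mul (hpos k y).ne' (hen j).ne'] at hlog
  have hgain : 0 ≤ lam * (1 / (K : ℝ) * (Real.log (F k y) - Real.log (Fen K L F y) -
      (Real.log (F k j) - Real.log (Fen K L F j)))) :=
    mul_nonneg hlam.le (mul_nonneg (by positivity) (by linarith))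
  have hy : 0 < 1 / F k y := one_div_pos.2 (hpos k y)
  rw [hfirst] at hzero
  linarith
end
end

section
/- Let λ > 0, K ≥ 1, let t_1,…,t_K ∈ (0,1) and set p = (1/K)∑_{k=1}^K t_k. Then it is impossible that the equation (λ/K)·log( p(1 − t_k) / ( t_k(1 − p) ) ) = 1/t_k holds simultaneously for all k ∈ {1,…,K}. -/
/-- The algebraic core of the proof of Appendix Theorem B.1: for `λ > 0` and
`t_1, …, t_K ∈ (0,1)` with average `p = (1/K) ∑_k t_k`, the equations
`(λ/K)·log( p(1 − t_k) / ( t_k(1 − p) ) ) = 1/t_k` cannot hold simultaneously for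
all `k`. -/
theorem jsd_kkt_system_no_solution (lam : ℝ) (hlam : 0 < lam) (K : ℕ) (hK : 1 ≤ K)
    (t : Fin K → ℝ) (ht : ∀ k, t k ∈ Set.Ioo (0 : ℝ) 1)
    (p : ℝ) (hp : p = (1 / (K : ℝ)) * ∑ k, t k) :
    ¬ ∀ k, (lam / K) * Real.log (p * (1 - t k) / (t k * (1 - p))) = 1 / t k := by
  intro h
  have hKpos : (0 : ℝ) < K := by exact_mod_cast hK
  have hsum : ∑ _k : Fin K, p = ∑ k, t k := by
    rw [Finset.sum_const, Finset.card_univ, Fintype.card_fin, nsmul_eq_mul, hp]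
    field_simp
  obtain ⟨k, -, hk⟩ := Finset.exists_le_of_sum_le
    (Finset.univ_nonempty_iff.mpr ⟨(⟨0, hK⟩ : Fin K)⟩) hsum.le
  obtain ⟨ht0, ht1⟩ := ht k
  have hp0 : 0 ≤ p := by
    rw [hp]
    exact mul_nonneg (by positivity) (Finset.sum_nonneg fun i _ => (ht i).1.le)
  have hden : 0 < t k * (1 - p) := mul_pos ht0 (by linarith)
  have hlog : Real.log (p * (1 - t k) / (t k * (1 - p))) ≤ 0 := by
    apply Real.log_nonpos
    · exact div_nonneg (mul_nonneg hp0 (by linarith)) hden.le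
    · rw [div_le_one hden]
      linarith
  have hle := mul_nonpos_of_nonneg_of_nonpos (div_pos hlam hKpos).le hlog
  have hpos : 0 < 1 / t k := one_div_pos.mpr ht0
  linarith [h k]
end
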